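/- arXiv:0708.1813 — 3 statements merged into one kernel-verified Lean document; each statement's English description precedes it below -/
import Mathlib

section
/- Consider the quadratic stochastic operators V_0 and V_1 on the simplex S^2 defined by (V_0x)_1 = x_1x_2 + x_1x_3, (V_0x)_2 = x_1² + x_2² + x_3² + x_1x_2 + x_2x_3 + x_1x_3, (V_0x)_3 = x_2x_3, and (V_1x)_1 = x_1² + x_2² + x_3² + x_1x_2 + x_2x_3 + x_1x_3, (V_1x)_2 = x_1x_2 + x_1x_3, (V_1x)_3 = x_2x_3. Then V_0 and V_1 are both dissipative, but for every λ ∈ (0,1) the operator V_λ = λV_1 + (1−λ)V_0 is not dissipative. In particular, the set of dissipative quadratic stochastic operators is not convex. -/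
open Finset Filter Topology

/-- Membership in the simplex `S^{m-1}`. -/
def InSimplex {m : ℕ} (x : Fin m → ℝ) : Prop :=
  (∀ i, 0 ≤ x i) ∧ ∑ i, x i = 1

/-- The decreasing rearrangement `x↓` of a vector. -/
noncomputable def dsort {m : ℕ} (x : Fin m → ℝ) : Fin m → ℝ :=
  fun i => x (Tuple.sort x i.rev)

/-- The sum of the `k` largest coordinates of `x`. -/
noncomputable def topSum {m : ℕ} (x : Fin m → ℝ) (k : ℕ) : ℝ :=
  ∑ i ∈ Finset.univ.filter (fun i : Fin m => (i : ℕ) < k), dsort x i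

/-- `Maj x y` means `x ≺ y` : `x` is majorized by `y`. -/
def Maj {m : ℕ} (x y : Fin m → ℝ) : Prop :=
  (∀ k, 1 ≤ k → k ≤ m - 1 → topSum x k ≤ topSum y k) ∧ ∑ i, x i = ∑ i, y i

/-- The `k`-th vertex of the simplex. -/
def vertex {m : ℕ} (k : Fin m) : Fin m → ℝ := fun i => if i = k then 1 else 0

/-- The quadratic stochastic operator associated to coefficients `p`. -/
def qso {m : ℕ} (p : Fin m → Fin m → Fin m → ℝ) (x : Fin m → ℝ) : Fin m → ℝ :=
  fun k => ∑ i, ∑ j, p i j k * x i * x j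

/-- Conditions on the heredity coefficients of a q.s.o. -/
def IsQSO {m : ℕ} (p : Fin m → Fin m → Fin m → ℝ) : Prop :=
  (∀ i j k, 0 ≤ p i j k) ∧ (∀ i j k, p i j k = p j i k) ∧ (∀ i j, ∑ k, p i j k = 1)

/-- The operator `V₀`. -/
noncomputable def V0 : (Fin 3 → ℝ) → Fin 3 → ℝ := fun x =>
  ![x 0 * x 1 + x 0 * x 2,
    x 0 ^ 2 + x 1 ^ 2 + x 2 ^ 2 + x 0 * x 1 + x 1 * x 2 + x 0 * x 2,
    x 1 * x 2]

/-- The operator `V₁`. -/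
noncomputable def V1 : (Fin 3 → ℝ) → Fin 3 → ℝ := fun x =>
  ![x 0 ^ 2 + x 1 ^ 2 + x 2 ^ 2 + x 0 * x 1 + x 1 * x 2 + x 0 * x 2,
    x 0 * x 1 + x 0 * x 2,
    x 1 * x 2]

theorem topSum_one (x : Fin 3 → ℝ) : topSum x 1 = x (Tuple.sort x 2) := by
  have h : Finset.univ.filter (fun i : Fin 3 => (i : ℕ) < 1) = {0} := by decide
  rw [topSum, h, Finset.sum_singleton]
  rfl

theorem topSum_two (x : Fin 3 → ℝ) : topSum x 2 = ∑ i, x i - x (Tuple.sort x 0) := by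
  have h : Finset.univ.filter (fun i : Fin 3 => (i : ℕ) < 2) = {0, 1} := by decide
  have hx : ∑ i, x i = ∑ i, x (Tuple.sort x i) := (Equiv.sum_comp (Tuple.sort x) x).symm
  rw [topSum, h, Finset.sum_pair (by decide), hx, Fin.sum_univ_three]
  change x (Tuple.sort x 2) + x (Tuple.sort x 1) = _
  ring

theorem le_sort_two (x : Fin 3 → ℝ) (i : Fin 3) : x i ≤ x (Tuple.sort x 2) := by
  have h := Tuple.monotone_sort x (Fin.le_last ((Tuple.sort x).symm i))
  simpa using h

theorem sort_zero_le (x : Fin 3 → ℝ) (i : Fin 3) : x (Tuple.sort x 0) ≤ x i := by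
  have h := Tuple.monotone_sort x (Fin.zero_le ((Tuple.sort x).symm i))
  simpa using h

/-- In dimension three, majorization amounts to comparing the largest and smallest coordinates. -/
theorem maj_of_extremes {x y : Fin 3 → ℝ} (hmax : ∀ i, ∃ j, x i ≤ y j)
    (hmin : ∀ i, ∃ j, y j ≤ x i) (hsum : ∑ i, x i = ∑ i, y i) : Maj x y := by
  refine ⟨fun k hk hk' => ?_, hsum⟩
  obtain rfl | rfl : k = 1 ∨ k = 2 := by omega
  · obtain ⟨j, hj⟩ := hmax (Tuple.sort x 2)
    rw [topSum_one, topSum_one]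
    exact hj.trans (le_sort_two y j)
  · obtain ⟨j, hj⟩ := hmin (Tuple.sort x 0)
    rw [topSum_two, topSum_two, hsum]
    linarith [sort_zero_le y j]

theorem Maj.exists_ge {x y : Fin 3 → ℝ} (h : Maj x y) (i : Fin 3) : ∃ j, x i ≤ y j := by
  have h1 := h.1 1 le_rfl (by norm_num)
  rw [topSum_one, topSum_one] at h1
  exact ⟨_, (le_sort_two x i).trans h1⟩

theorem V0_dissipative {x : Fin 3 → ℝ} (hx : InSimplex x) : Maj x (V0 x) := by
  obtain ⟨hpos, hsum⟩ := hx
  have h0 := hpos 0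
  have h1 := hpos 1
  have h2 := hpos 2
  rw [Fin.sum_univ_three] at hsum
  have e : x 0 = 1 - x 1 - x 2 := by linarith
  have h01 := mul_nonneg h0 h1
  have h12 := mul_nonneg h1 h2
  have h02 := mul_nonneg h0 h2
  refine maj_of_extremes (fun i => ⟨1, ?_⟩) (fun i => ?_) ?_
  · fin_cases i <;> simp [V0] <;> nlinarith
  · fin_cases i
    · exact ⟨0, by simp [V0]; nlinarith⟩
    · exact ⟨2, by simp [V0]; nlinarith⟩
    · exact ⟨2, by simp [V0]; nlinarith⟩
  · simp only [Fin.sum_univ_three]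
    simp [V0]
    rw [e]
    ring

theorem V1_eq_V0_comp_swap (x : Fin 3 → ℝ) : V1 x = V0 x ∘ Equiv.swap 0 1 := by
  funext i
  fin_cases i <;> simp [V0, V1, Equiv.swap_apply_def]

theorem Maj.comp_perm {x y : Fin 3 → ℝ} (h : Maj x y) (σ : Equiv.Perm (Fin 3)) :
    Maj x (y ∘ σ) := by
  have hy : topSum (y ∘ σ) = topSum y := by
    funext k
    have hs : dsort (y ∘ σ) = dsort y := by
      funext i
      exact congrFun (Tuple.comp_perm_comp_sort_eq_comp_sort (f := y) (σ := σ)) i.rev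
    simp only [topSum, hs]
  refine ⟨fun k hk hk' => hy ▸ h.1 k hk hk', ?_⟩
  rw [h.2]
  exact (Equiv.sum_comp σ y).symm

theorem stmt3 :
    (∀ x, InSimplex x → Maj x (V0 x)) ∧ (∀ x, InSimplex x → Maj x (V1 x)) ∧
      ∀ lam : ℝ, 0 < lam → lam < 1 →
        ¬ (∀ x, InSimplex x →
            Maj x (fun k => lam * V1 x k + (1 - lam) * V0 x k)) := by
  refine ⟨fun x hx => V0_dissipative hx, fun x hx => ?_, fun lam h0 h1 h => ?_⟩
  · rw [V1_eq_V0_comp_swap]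
    exact (V0_dissipative hx).comp_perm _
  · have hv : InSimplex (vertex (0 : Fin 3)) :=
      ⟨fun i => by unfold vertex; split_ifs <;> norm_num, by simp [vertex]⟩
    obtain ⟨j, hj⟩ := (h _ hv).exists_ge 0
    fin_cases j <;> simp [vertex, V0, V1] at hj <;> linarith
end

section
/- Let V be a dissipative quadratic stochastic operator on S^{m-1} with coefficients satisfying p_{ii,1} = 1 for all i ≠ 2 and p_{22,2} = 1. Then for every x ∈ S^{m-1}, ∑_{k=3}^m (V^n x)_k → 0 as n → ∞; consequently the ω-limit set of the trajectory of any initial point x is contained in the convex hull of {e_1, e_2}. -/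
open Finset Filter Topology

lemma le_topSum_one {m : ℕ} (x : Fin m → ℝ) (i : Fin m) : x i ≤ topSum x 1 := by
  have hm : 0 < m := i.pos
  have hf : Finset.univ.filter (fun i : Fin m => (i : ℕ) < 1) = {⟨0, hm⟩} := by
    ext j; simp [Fin.ext_iff]
  rw [topSum, hf, Finset.sum_singleton, dsort]
  have h := Tuple.monotone_sort x
    (show (Tuple.sort x).symm i ≤ (⟨0, hm⟩ : Fin m).rev by
      rw [Fin.le_def, Fin.val_rev]
      have := ((Tuple.sort x).symm i).isLt
      simp only
      omega)
  simpa using h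

lemma exists_topSum_one_eq {m : ℕ} (hm : 0 < m) (x : Fin m → ℝ) :
    ∃ i, topSum x 1 = x i := by
  have hf : Finset.univ.filter (fun i : Fin m => (i : ℕ) < 1) = {⟨0, hm⟩} := by
    ext j; simp [Fin.ext_iff]
  exact ⟨_, by rw [topSum, hf, Finset.sum_singleton, dsort]⟩

lemma sum_qso {m : ℕ} (p : Fin m → Fin m → Fin m → ℝ) (A : Finset (Fin m)) (x : Fin m → ℝ) :
    ∑ k ∈ A, qso p x k = ∑ i, ∑ j, (∑ k ∈ A, p i j k) * (x i * x j) := by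
  simp only [qso, Finset.sum_mul, mul_assoc]
  rw [Finset.sum_comm]
  exact Finset.sum_congr rfl fun i _ => Finset.sum_comm

lemma InSimplex.qso {m : ℕ} {p : Fin m → Fin m → Fin m → ℝ} (hp : IsQSO p) {x : Fin m → ℝ}
    (hx : InSimplex x) : InSimplex (qso p x) := by
  refine ⟨fun k => Finset.sum_nonneg fun i _ => Finset.sum_nonneg fun j _ =>
    mul_nonneg (mul_nonneg (hp.1 i j k) (hx.1 i)) (hx.1 j), ?_⟩
  rw [sum_qso]
  simp only [hp.2.2, one_mul, ← Finset.mul_sum, hx.2, mul_one]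

lemma InSimplex.iterate_qso {m : ℕ} {p : Fin m → Fin m → Fin m → ℝ} (hp : IsQSO p)
    {x : Fin m → ℝ} (hx : InSimplex x) (n : ℕ) : InSimplex ((_root_.qso p)^[n] x) := by
  induction n with
  | zero => exact hx
  | succ n ih => rw [Function.iterate_succ_apply']; exact ih.qso hp

lemma IsQSO.sum_le_one {m : ℕ} {p : Fin m → Fin m → Fin m → ℝ} (hp : IsQSO p)
    (i j : Fin m) (A : Finset (Fin m)) : ∑ k ∈ A, p i j k ≤ 1 := by
  rw [← hp.2.2 i j]
  exact Finset.sum_le_sum_of_subset_of_nonneg (Finset.subset_univ A) fun k _ _ => hp.1 i j k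

/-- If a dissipative operator sends the vertex `i` to the vertex `c`, then every offspring
distribution with parent `i` gives weight at least `1/2` to `c`. -/
lemma half_le_of_dissipative {m : ℕ} (hm : 2 ≤ m) {p : Fin m → Fin m → Fin m → ℝ} (hp : IsQSO p)
    (hdiss : ∀ x, InSimplex x → Maj x (qso p x)) {i j c : Fin m} (hij : i ≠ j)
    (hc : p i i c = 1) : 1 / 2 ≤ p i j c := by
  refine le_of_forall_pos_le_add fun ε hε => ?_
  obtain ⟨b, hb, hbε, hb4⟩ : ∃ b : ℝ, 0 < b ∧ b ≤ ε ∧ b ≤ 1 / 4 :=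
    ⟨min ε (1 / 4), by positivity, min_le_left _ _, min_le_right _ _⟩
  set x : Fin m → ℝ := Pi.single i (1 - b) + Pi.single j b with hx
  have hxi : x i = 1 - b := by simp [hx, hij]
  have hxS : InSimplex x := by
    refine ⟨fun k => ?_, by simp [hx, Finset.sum_add_distrib]⟩
    have h1 : 0 ≤ (Pi.single i (1 - b) : Fin m → ℝ) := Pi.single_nonneg.2 (by linarith)
    have h2 : 0 ≤ (Pi.single j b : Fin m → ℝ) := Pi.single_nonneg.2 hb.le
    exact add_nonneg (h1 k) (h2 k)
  have hV : qso p x c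
      = (1 - b) ^ 2 + 2 * b * (1 - b) * p i j c + b ^ 2 * p j j c := by
    simp only [qso, hx, Pi.add_apply, mul_add, add_mul, Finset.sum_add_distrib, Pi.single_apply,
      mul_ite, ite_mul, mul_zero, zero_mul, Finset.sum_ite_eq', Finset.mem_univ, if_true]
    rw [hc, hp.2.1 j i c]
    ring
  have hVS := hxS.qso hp
  have hpij := hp.1 i j c
  have hpjj := hp.1 j j c
  have hpjj1 : p j j c ≤ 1 := by simpa using hp.sum_le_one j j {c}
  have hVc : 1 - b ≤ qso p x c := by
    obtain ⟨k, hk⟩ := exists_topSum_one_eq (by omega) (qso p x)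
    have h1 : 1 - b ≤ qso p x k := by
      rw [← hk, ← hxi]
      exact (le_topSum_one x i).trans ((hdiss x hxS).1 1 le_rfl (by omega))
    by_cases hkc : k = c
    · rwa [← hkc]
    · have h2 : qso p x c + qso p x k ≤ 1 := by
        rw [← hVS.2, ← Finset.sum_pair (Ne.symm hkc)]
        exact Finset.sum_le_sum_of_subset_of_nonneg (Finset.subset_univ _) fun l _ _ => hVS.1 l
      have h3 : (1 - b) ^ 2 ≤ qso p x c := by
        have : 0 ≤ 2 * b * (1 - b) * p i j c :=
          mul_nonneg (mul_nonneg (by linarith) (by linarith)) hpij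
        have : 0 ≤ b ^ 2 * p j j c := by positivity
        linarith
      nlinarith
  have h4 : b * (1 - b) ≤ b * (2 * (1 - b) * p i j c + b) := by nlinarith
  have h5 := le_of_mul_le_mul_left h4 hb
  nlinarith

/-- The mass outside `{a, b}` satisfies a quadratic decay estimate. -/
lemma sum_qso_le_of_half_le {m : ℕ} {p : Fin m → Fin m → Fin m → ℝ} (hp : IsQSO p)
    {a b : Fin m} (hab : a ≠ b) (ha : ∀ i, i ≠ b → p i i a = 1) (hb : p b b b = 1)
    (hhalf : ∀ i j c, i ≠ j → p i i c = 1 → 1 / 2 ≤ p i j c)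
    {x : Fin m → ℝ} (hx : InSimplex x) :
    ∑ k ∈ {a, b}ᶜ, qso p x k
      ≤ ∑ k ∈ {a, b}ᶜ, x k - (∑ k ∈ {a, b}ᶜ, x k) ^ 2 / 2 := by
  set T := ∑ k ∈ {a, b}ᶜ, x k with hT
  have hsum : x a + x b + T = 1 := by
    rw [← hx.2, ← Finset.sum_add_sum_compl {a, b} x, Finset.sum_pair hab]
  have htail : ∀ i j, ∑ k ∈ {a, b}ᶜ, p i j k = 1 - p i j a - p i j b := fun i j => by
    have := Finset.sum_add_sum_compl {a, b} (p i j)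
    rw [Finset.sum_pair hab, hp.2.2] at this
    linarith
  have hcoef : ∀ i j, ∑ k ∈ {a, b}ᶜ, p i j k ≤
      1 / 2 * ((if i = b then 0 else 1) * (if j = b then 0 else 1)
        - (if i = a then 1 else 0) * (if j = a then 1 else 0)) := by
    intro i j
    rw [htail]
    have h0 := hp.1 i j a
    have h1 := hp.1 i j b
    by_cases hij : i = j
    · subst hij
      by_cases hib : i = b
      · subst hib; simp [hab.symm, hb]; exact h0
      · have := ha i hib
        rw [if_neg hib]
        split_ifs <;> linarith
    · by_cases hib : i = b
      · subst hib
        have h2 := hhalf i j i hij hb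
        have h3 := hhalf j i a (Ne.symm hij) (ha j (Ne.symm hij))
        rw [hp.2.1] at h3
        simp [hab.symm]; linarith
      · have h2 := hhalf i j a hij (ha i hib)
        by_cases hjb : j = b
        · subst hjb
          have h3 := hhalf j i j (Ne.symm hij) hb
          rw [hp.2.1] at h3
          simp [hab.symm]; linarith
        · have h4 : ¬ (i = a ∧ j = a) := fun h => hij (h.1.trans h.2.symm)
          by_cases hia : i = a
          · have hja : j ≠ a := fun h => h4 ⟨hia, h⟩
            simp [hib, hjb, hja]; linarith
          · simp [hib, hjb, hia]; linarith
  have hu : ∑ i, (if i = b then 0 else 1) * x i = x a + T := by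
    have : ∀ i, (if i = b then 0 else 1) * x i = x i - if i = b then x i else 0 := fun i => by
      split_ifs <;> simp
    simp only [this, Finset.sum_sub_distrib, hx.2, Finset.sum_ite_eq', Finset.mem_univ, if_true]
    linarith
  have hv : ∑ i, (if i = a then 1 else 0) * x i = x a := by simp
  calc ∑ k ∈ {a, b}ᶜ, qso p x k
      = ∑ i, ∑ j, (∑ k ∈ {a, b}ᶜ, p i j k) * (x i * x j) := sum_qso p _ x
    _ ≤ ∑ i, ∑ j, (1 / 2 * ((if i = b then 0 else 1) * (if j = b then 0 else 1)
        - (if i = a then 1 else 0) * (if j = a then 1 else 0))) * (x i * x j) :=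
      Finset.sum_le_sum fun i _ => Finset.sum_le_sum fun j _ =>
        mul_le_mul_of_nonneg_right (hcoef i j) (mul_nonneg (hx.1 i) (hx.1 j))
    _ = 1 / 2 * ((∑ i, (if i = b then 0 else 1) * x i) * (∑ j, (if j = b then 0 else 1) * x j)
        - (∑ i, (if i = a then 1 else 0) * x i) * (∑ j, (if j = a then 1 else 0) * x j)) := by
      rw [Finset.sum_mul_sum, Finset.sum_mul_sum, ← Finset.sum_sub_distrib, Finset.mul_sum]
      refine Finset.sum_congr rfl fun i _ => ?_
      rw [← Finset.sum_sub_distrib, Finset.mul_sum]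
      exact Finset.sum_congr rfl fun j _ => by ring
    _ = x a * T + T ^ 2 / 2 := by rw [hu, hv]; ring
    _ ≤ T - T ^ 2 / 2 := by
      have h1 : 0 ≤ T := Finset.sum_nonneg fun k _ => hx.1 k
      have h2 := hx.1 b
      nlinarith [mul_nonneg h1 h2]

lemma tendsto_zero_of_le_sub_sq {t : ℕ → ℝ} (h0 : ∀ n, 0 ≤ t n)
    (h : ∀ n, t (n + 1) ≤ t n - t n ^ 2 / 2) : Tendsto t atTop (𝓝 0) := by
  have hanti : Antitone t := antitone_nat_of_succ_le fun n => by nlinarith [h n, sq_nonneg (t n)]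
  have hlim := tendsto_atTop_ciInf hanti ⟨0, by rintro _ ⟨n, rfl⟩; exact h0 n⟩
  set L := ⨅ n, t n
  have hL : L ≤ L - L ^ 2 / 2 :=
    le_of_tendsto_of_tendsto' (hlim.comp (tendsto_add_atTop_nat 1))
      (hlim.sub ((hlim.pow 2).div_const 2)) h
  have : L = 0 := pow_eq_zero_iff (two_ne_zero) |>.1 (by nlinarith [sq_nonneg L])
  rwa [this] at hlim

lemma mem_segment_vertex {m : ℕ} {a b : Fin m} (hab : a ≠ b) {z : Fin m → ℝ} (hz : InSimplex z)
    (hT : ∑ k ∈ {a, b}ᶜ, z k = 0) : z ∈ segment ℝ (vertex a) (vertex b) := by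
  have hsum := Finset.sum_add_sum_compl {a, b} z
  rw [Finset.sum_pair hab, hT, hz.2, add_zero] at hsum
  refine ⟨z a, z b, hz.1 a, hz.1 b, hsum, ?_⟩
  ext k
  by_cases hka : k = a
  · simp [vertex, hka, hab]
  by_cases hkb : k = b
  · simp [vertex, hkb, hab.symm]
  · have := (Finset.sum_eq_zero_iff_of_nonneg fun k _ => hz.1 k).1 hT k (by simp [hka, hkb])
    simp [vertex, hka, hkb, this]

theorem stmt12 (m : ℕ) (hm : 2 ≤ m) (p : Fin m → Fin m → Fin m → ℝ) (hp : IsQSO p)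
    (hdiss : ∀ x, InSimplex x → Maj x (qso p x))
    (hii : ∀ i : Fin m, i ≠ ⟨1, by omega⟩ → p i i ⟨0, by omega⟩ = 1)
    (h22 : p ⟨1, by omega⟩ ⟨1, by omega⟩ ⟨1, by omega⟩ = 1) :
    ∀ x, InSimplex x →
      Tendsto (fun n => ∑ k ∈ Finset.univ.filter (fun k : Fin m => 2 ≤ (k : ℕ)),
        (qso p)^[n] x k) atTop (𝓝 0) ∧
      ∀ z : Fin m → ℝ,
        (∃ φ : ℕ → ℕ, StrictMono φ ∧
          Tendsto (fun j => (qso p)^[φ j] x) atTop (𝓝 z)) →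
        z ∈ segment ℝ (vertex (⟨0, by omega⟩ : Fin m)) (vertex (⟨1, by omega⟩ : Fin m)) := by
  intro x hx
  have hab : (⟨0, by omega⟩ : Fin m) ≠ ⟨1, by omega⟩ := by simp
  have hA : Finset.univ.filter (fun k : Fin m => 2 ≤ (k : ℕ))
      = {⟨0, by omega⟩, ⟨1, by omega⟩}ᶜ := by
    ext k; simp [Fin.ext_iff]; omega
  rw [hA]
  clear hA
  generalize (⟨0, by omega⟩ : Fin m) = a at *
  generalize (⟨1, by omega⟩ : Fin m) = b at *
  have hS := hx.iterate_qso hp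
  have htail := tendsto_zero_of_le_sub_sq
    (t := fun n => ∑ k ∈ {a, b}ᶜ, (qso p)^[n] x k)
    (fun n => Finset.sum_nonneg fun k _ => (hS n).1 k) fun n => by
      simp only [Function.iterate_succ_apply']
      exact sum_qso_le_of_half_le hp hab hii h22
        (fun i j c hij hc => half_le_of_dissipative hm hp hdiss hij hc) (hS n)
  refine ⟨htail, ?_⟩
  rintro z ⟨φ, hφ, hz⟩
  have hzk := tendsto_pi_nhds.1 hz
  refine mem_segment_vertex hab
    ⟨fun k => ge_of_tendsto' (hzk k) fun n => (hS _).1 k, ?_⟩ ?_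
  · refine tendsto_nhds_unique (tendsto_finsetSum _ fun k _ => hzk k) ?_
    simp only [(hS _).2]
    exact tendsto_const_nhds
  · exact tendsto_nhds_unique (tendsto_finsetSum _ fun k _ => hzk k)
      (htail.comp hφ.tendsto_atTop)
end

section
/- Let V : S^{m-1} → S^{m-1} be any continuous dissipative stochastic operator. Then V is ergodic: for every x ∈ S^{m-1} the limit lim_{n→∞} (x + Vx + V²x + … + V^{n−1}x)/n exists. In particular, every dissipative cubic stochastic operator is ergodic. -/
open Finset Filter Topology

/-- The permutation that sorts a vector in decreasing order. -/
noncomputable def dsortPerm {m : ℕ} (x : Fin m → ℝ) : Equiv.Perm (Fin m) :=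
  Fin.revPerm.trans (Tuple.sort x)

theorem dsort_eq_comp {m : ℕ} (x : Fin m → ℝ) : dsort x = x ∘ dsortPerm x := rfl

theorem dsort_comp_symm {m : ℕ} (x : Fin m → ℝ) : dsort x ∘ (dsortPerm x).symm = x := by
  ext i
  simp [dsort_eq_comp]

theorem InSimplex.comp_perm {m : ℕ} {x : Fin m → ℝ} (hx : InSimplex x)
    (σ : Equiv.Perm (Fin m)) : InSimplex (x ∘ σ) :=
  ⟨fun i => hx.1 (σ i), (Equiv.sum_comp σ x).trans hx.2⟩

theorem InSimplex.dsort {m : ℕ} {x : Fin m → ℝ} (hx : InSimplex x) : InSimplex (dsort x) :=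
  hx.comp_perm (dsortPerm x)

theorem topSum_zero {m : ℕ} (x : Fin m → ℝ) : topSum x 0 = 0 := by
  simp [topSum]

theorem topSum_of_le {m : ℕ} (x : Fin m → ℝ) {k : ℕ} (hk : m ≤ k) :
    topSum x k = ∑ i, x i := by
  have h : Finset.univ.filter (fun i : Fin m => (i : ℕ) < k) = Finset.univ :=
    Finset.filter_true_of_mem fun i _ => i.2.trans_le hk
  rw [topSum, h]
  exact Equiv.sum_comp (dsortPerm x) x

theorem topSum_succ {m : ℕ} (x : Fin m → ℝ) (i : Fin m) :
    topSum x (i + 1) = topSum x i + dsort x i := by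
  have h : Finset.univ.filter (fun j : Fin m => (j : ℕ) < i + 1) =
      insert i (Finset.univ.filter fun j : Fin m => (j : ℕ) < i) := by
    ext j
    simp only [Finset.mem_filter, Finset.mem_univ, true_and, Finset.mem_insert, Fin.ext_iff]
    omega
  rw [topSum, h, Finset.sum_insert (by simp), topSum, add_comm]

theorem topSum_le_one {m : ℕ} {x : Fin m → ℝ} (hx : InSimplex x) (k : ℕ) : topSum x k ≤ 1 :=
  (Finset.sum_le_sum_of_subset_of_nonneg (Finset.filter_subset _ _)
    fun i _ _ => hx.dsort.1 i).trans_eq hx.dsort.2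

theorem Maj.topSum_le {m : ℕ} {x y : Fin m → ℝ} (h : Maj x y) (k : ℕ) :
    topSum x k ≤ topSum y k := by
  rcases Nat.eq_zero_or_pos k with rfl | hk
  · simp [topSum_zero]
  · by_cases hkm : k ≤ m - 1
    · exact h.1 k hk hkm
    · rw [topSum_of_le x (by omega), topSum_of_le y (by omega), h.2]

/-- The decreasing rearrangements of a sequence increasing for majorization converge. -/
theorem exists_tendsto_dsort {m : ℕ} {u : ℕ → Fin m → ℝ} (hu : ∀ n, InSimplex (u n))
    (hmaj : ∀ n, Maj (u n) (u (n + 1))) :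
    ∃ y, InSimplex y ∧ Tendsto (fun n => dsort (u n)) atTop (𝓝 y) := by
  have hlim : ∀ k, ∃ t, Tendsto (fun n => topSum (u n) k) atTop (𝓝 t) := fun k =>
    ⟨_, tendsto_atTop_ciSup (monotone_nat_of_le_succ fun n => (hmaj n).topSum_le k)
      ⟨1, by rintro _ ⟨n, rfl⟩; exact topSum_le_one (hu n) k⟩⟩
  choose t ht using hlim
  have hy : Tendsto (fun n => dsort (u n)) atTop (𝓝 fun i : Fin m => t (i + 1) - t i) := by
    refine tendsto_pi_nhds.2 fun i => ((ht (i + 1)).sub (ht i)).congr fun n => ?_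
    rw [topSum_succ, add_sub_cancel_left]
  exact ⟨_, (isClosed_stdSimplex ℝ (Fin m)).mem_of_tendsto hy
    (Eventually.of_forall fun n => (hu n).dsort), hy⟩

/-- A sequence taking finitely many values and eventually obeying a first-order recursion is
eventually periodic. -/
theorem exists_eventually_periodic {E : Type*} {a : ℕ → E} {V : E → E}
    (hfin : (Set.range a).Finite) (hrec : ∀ᶠ n in atTop, a (n + 1) = V (a n)) :
    ∃ N p, 0 < p ∧ ∀ n, N ≤ n → a (n + p) = a n := by
  obtain ⟨N, hN⟩ := eventually_atTop.1 hrec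
  have : Finite (Set.range a) := hfin
  obtain ⟨i, j, hij, he⟩ := Finite.exists_ne_map_eq_of_infinite
    fun n : ℕ => (⟨a (N + n), Set.mem_range_self _⟩ : Set.range a)
  simp only [Subtype.mk.injEq] at he
  wlog hlt : i < j generalizing i j
  · exact this j i hij.symm he.symm (by omega)
  refine ⟨N + i, j - i, by omega, fun n hn => ?_⟩
  induction n, hn using Nat.le_induction with
  | base => rw [he]; congr 1; omega
  | succ n hn ih =>
    rw [add_right_comm, hN _ (by omega), hN _ (by omega), ih]

/-- The Cesàro means of an eventually periodic sequence converge. -/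
theorem exists_tendsto_cesaro_of_eventually_periodic {E : Type*} [NormedAddCommGroup E]
    [NormedSpace ℝ E] {a : ℕ → E} {N p : ℕ} (hp : 0 < p)
    (ha : ∀ n, N ≤ n → a (n + p) = a n) :
    ∃ L, Tendsto (fun n : ℕ => (n : ℝ)⁻¹ • ∑ k ∈ Finset.range n, a k) atTop (𝓝 L) := by
  have hp' : (p : ℝ) ≠ 0 := by positivity
  set A : ℕ → E := fun n => ∑ k ∈ Finset.range n, a k with hA
  set L : E := (p : ℝ)⁻¹ • (A (N + p) - A N) with hL
  have hstep : ∀ n, N ≤ n → A (n + p) - A n = (p : ℝ) • L := by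
    intro n hn
    induction n, hn using Nat.le_induction with
    | base => rw [hL, smul_inv_smul₀ hp']
    | succ n hn ih =>
      rw [← ih, add_right_comm]
      simp only [hA, Finset.sum_range_succ, ha n hn]
      abel
  set B : ℕ → E := fun n => A n - (n : ℝ) • L with hB
  have hBper : ∀ n, N ≤ n → B (n + p) = B n := by
    intro n hn
    have h := hstep n hn
    simp only [hB, Nat.cast_add, add_smul, ← h]
    abel
  have hBbdd : ∀ n, ‖B n‖ ≤ ∑ k ∈ Finset.range (N + p), ‖B k‖ := by
    intro n
    induction n using Nat.strong_induction_on with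
    | _ n ih =>
      by_cases hn : n < N + p
      · exact Finset.single_le_sum (f := fun k => ‖B k‖) (fun k _ => norm_nonneg _)
          (Finset.mem_range.2 hn)
      · have h := hBper (n - p) (by omega)
        rw [Nat.sub_add_cancel (by omega)] at h
        rw [h]
        exact ih _ (by omega)
  have h0 : Tendsto (fun n : ℕ => (n : ℝ)⁻¹ • B n) atTop (𝓝 0) :=
    NormedField.tendsto_zero_smul_of_tendsto_zero_of_bounded
      (tendsto_inv_atTop_zero.comp tendsto_natCast_atTop_atTop)
      (isBoundedUnder_of ⟨_, hBbdd⟩)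
  refine ⟨L, ?_⟩
  have h1 := h0.add_const L
  rw [zero_add] at h1
  refine h1.congr' ?_
  filter_upwards [eventually_gt_atTop 0] with n hn
  have hn' : (n : ℝ) ≠ 0 := by positivity
  simp only [hB, smul_sub, inv_smul_smul₀ hn', sub_add_cancel]
  rfl

/-- If an orbit of a map, uniformly continuous on `S`, is asymptotic to a sequence with finitely
many values in `S`, then that sequence is eventually an orbit. -/
theorem eventually_succ_eq_of_finite_range {E : Type*} [MetricSpace E] {S : Set E} {V : E → E}
    (hV : UniformContinuousOn V S) {u a : ℕ → E} (hu : ∀ n, u n ∈ S) (ha : ∀ n, a n ∈ S)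
    (hrec : ∀ n, u (n + 1) = V (u n)) (hfin : (Set.range a).Finite)
    (hua : Tendsto (fun n => dist (u n) (a n)) atTop (𝓝 0)) :
    ∀ᶠ n in atTop, a (n + 1) = V (a n) := by
  have hfin' : (Set.range a ∪ V '' Set.range a).Finite := hfin.union (hfin.image V)
  obtain ⟨ε, hε, hsep⟩ : ∃ ε > 0, ∀ b ∈ Set.range a ∪ V '' Set.range a,
      ∀ c ∈ Set.range a ∪ V '' Set.range a, dist b c < ε → b = c := by
    rcases Set.subsingleton_or_nontrivial (Set.range a ∪ V '' Set.range a) with hs | hs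
    · exact ⟨1, one_pos, fun b hb c hc _ => hs hb hc⟩
    · refine ⟨_, hfin'.infsep_pos_iff_nontrivial.2 hs, fun b hb c hc h => ?_⟩
      by_contra hbc
      exact h.not_ge (Set.infsep_le_dist_of_mem hb hc hbc)
  obtain ⟨δ, hδ, hVδ⟩ := Metric.uniformContinuousOn_iff.1 hV (ε / 2) (half_pos hε)
  filter_upwards [hua.eventually_lt_const hδ,
    (tendsto_add_atTop_iff_nat 1).2 hua |>.eventually_lt_const (half_pos hε)] with n h1 h2
  refine hsep _ (.inl ⟨_, rfl⟩) _ (.inr ⟨_, ⟨n, rfl⟩, rfl⟩) ?_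
  have h3 := hVδ _ (hu n) _ (ha n) h1
  rw [← hrec] at h3
  linarith [dist_triangle_left (a (n + 1)) (V (a n)) (u (n + 1))]

theorem stmt19 (m : ℕ) (V : (Fin m → ℝ) → Fin m → ℝ)
    (hmap : ∀ x, InSimplex x → InSimplex (V x))
    (hcont : ContinuousOn V {x | InSimplex x})
    (hdiss : ∀ x, InSimplex x → Maj x (V x)) :
    ∀ x, InSimplex x → ∃ L : Fin m → ℝ,
      Tendsto (fun n : ℕ => (n : ℝ)⁻¹ • ∑ k ∈ Finset.range n, V^[k] x)
        atTop (𝓝 L) := by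
  intro x hx
  set u : ℕ → Fin m → ℝ := fun n => V^[n] x with hu_def
  have hrec : ∀ n, u (n + 1) = V (u n) := fun n => Function.iterate_succ_apply' V n x
  have hu : ∀ n, InSimplex (u n) := by
    intro n
    induction n with
    | zero => exact hx
    | succ n ih => rw [hrec]; exact hmap _ ih
  obtain ⟨y, hy, hlim⟩ := exists_tendsto_dsort hu fun n => by rw [hrec]; exact hdiss _ (hu n)
  set a : ℕ → Fin m → ℝ := fun n => y ∘ (dsortPerm (u n)).symm
  have hfin : (Set.range a).Finite :=
    (Set.finite_range fun σ : Equiv.Perm (Fin m) => y ∘ σ).subset <| by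
      rintro _ ⟨n, rfl⟩
      exact ⟨_, rfl⟩
  have hdist : Tendsto (fun n => dist (u n) (a n)) atTop (𝓝 0) := by
    refine squeeze_zero (fun _ => dist_nonneg) (fun n => ?_) (tendsto_iff_dist_tendsto_zero.1 hlim)
    refine (dist_pi_le_iff dist_nonneg).2 fun i => ?_
    conv_lhs => rw [← dsort_comp_symm (u n)]
    exact dist_le_pi_dist (dsort (u n)) y ((dsortPerm (u n)).symm i)
  have hunif : UniformContinuousOn V {x | InSimplex x} :=
    (isCompact_stdSimplex ℝ (Fin m)).uniformContinuousOn_of_continuous hcont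
  obtain ⟨N, p, hp, hper⟩ := exists_eventually_periodic hfin
    (eventually_succ_eq_of_finite_range hunif hu (fun n => hy.comp_perm _) hrec hfin hdist)
  obtain ⟨L, hL⟩ := exists_tendsto_cesaro_of_eventually_periodic hp hper
  have hsub : Tendsto (fun n => u n - a n) atTop (𝓝 0) := by
    rw [tendsto_zero_iff_norm_tendsto_zero]
    simpa only [dist_eq_norm] using hdist
  refine ⟨L, ?_⟩
  have h := hsub.cesaro_smul.add hL
  rw [zero_add] at h
  refine h.congr fun n => ?_
  rw [← smul_add, ← Finset.sum_add_distrib]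
  simp only [sub_add_cancel, hu_def]
end
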